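/- Suppose the decision space U is finite and that (Ω, ℬ, P, T) is conditionally weak mixing relative to 𝒴_{−∞,0}. Then every mean-optimal strategy ũ is weakly pathwise optimal: for every admissible strategy u and every ε > 0, P[L_T(u) − L_T(ũ) ≥ −ε] → 1 as T → ∞. -/

import Mathlib

open MeasureTheory Filter Set
open scoped ENNReal Topology symmDiff

noncomputable section

namespace ErgodicDecisions

variable {Ω U : Type*}

/-- The `ℤ`-indexed iterates of an invertible transformation `T` with inverse `S`:
`iter T S n = Tⁿ` for `n ≥ 0` and `iter T S (-n) = Sⁿ`. -/
def iter (T S : Ω → Ω) : ℤ → Ω → Ω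
  | Int.ofNat n => T^[n]
  | Int.negSucc n => S^[n + 1]

variable {m0 : MeasurableSpace Ω} [mU : MeasurableSpace U]

/-- The observation σ-field `𝒴_{m,n} = ⋁_{k=m}^{n} T^{-k} 𝒴`. -/
def obsField (T S : Ω → Ω) (Y : MeasurableSpace Ω) (m n : ℤ) : MeasurableSpace Ω :=
  ⨆ k ∈ Set.Icc m n, MeasurableSpace.comap (iter T S k) Y

/-- The observation σ-field `𝒴_{-∞,n} = ⋁_{k ≤ n} T^{-k} 𝒴`. -/
def obsFieldLE (T S : Ω → Ω) (Y : MeasurableSpace Ω) (n : ℤ) : MeasurableSpace Ω :=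
  ⨆ k ∈ Set.Iic n, MeasurableSpace.comap (iter T S k) Y

/-- `𝕌_{m,n}`: the set of `𝒴_{m,n}`-measurable decision maps `Ω → U`. -/
def Umn (T S : Ω → Ω) (Y : MeasurableSpace Ω) (m n : ℤ) : Set (Ω → U) :=
  {v | Measurable[obsField T S Y m n] v}

/-- `𝕌_n = ⋃_{m ≤ n} 𝕌_{m,n}`. -/
def Un (T S : Ω → Ω) (Y : MeasurableSpace Ω) (n : ℤ) : Set (Ω → U) :=
  ⋃ m ∈ Set.Iic n, Umn T S Y m n

/-- The loss at time `n` of the decision map `v`: `ℓ_n(v)(ω) = ℓ(v(ω), Tⁿω)`. -/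
def lossAt (T S : Ω → Ω) (ℓ : U → Ω → ℝ) (n : ℤ) (v : Ω → U) (ω : Ω) : ℝ :=
  ℓ (v ω) (iter T S n ω)

/-- An admissible strategy: `u_k` is `𝒴_{0,k}`-measurable for every `k ≥ 1`. -/
def Admissible (T S : Ω → Ω) (Y : MeasurableSpace Ω) (u : ℕ → Ω → U) : Prop :=
  ∀ k : ℕ, 1 ≤ k → u k ∈ Umn T S Y 0 (k : ℤ)

/-- The time-average loss `L_T(u) = T⁻¹ ∑_{k=1}^T ℓ_k(u_k)`. -/
def avgLoss (T S : Ω → Ω) (ℓ : U → Ω → ℝ) (u : ℕ → Ω → U) (n : ℕ) (ω : Ω) : ℝ :=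
  (n : ℝ)⁻¹ * ∑ k ∈ Finset.Icc 1 n, lossAt T S ℓ (k : ℤ) (u k) ω

/-- `g` is an essential infimum (an a.e.-greatest lower bound among random variables)
of the family `(f i)_{i ∈ S₀}` under `P`. -/
def IsEssInfFam {ι : Type*} (P : Measure Ω) (S₀ : Set ι) (f : ι → Ω → ℝ) (g : Ω → ℝ) : Prop :=
  Measurable[m0] g ∧ (∀ i ∈ S₀, ∀ᵐ ω ∂P, g ω ≤ f i ω) ∧
    ∀ h : Ω → ℝ, Measurable[m0] h → (∀ i ∈ S₀, ∀ᵐ ω ∂P, h ω ≤ f i ω) → ∀ᵐ ω ∂P, h ω ≤ g ω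

/-- `g` is an essential supremum (an a.e.-least upper bound among random variables)
of the family `(f i)_{i ∈ S₀}` under `P`. -/
def IsEssSupFam {ι : Type*} (P : Measure Ω) (S₀ : Set ι) (f : ι → Ω → ℝ) (g : Ω → ℝ) : Prop :=
  Measurable[m0] g ∧ (∀ i ∈ S₀, ∀ᵐ ω ∂P, f i ω ≤ g ω) ∧
    ∀ h : Ω → ℝ, Measurable[m0] h → (∀ i ∈ S₀, ∀ᵐ ω ∂P, f i ω ≤ h ω) → ∀ᵐ ω ∂P, g ω ≤ h ω

/-- A mean-optimal strategy in the sense of Lemma 2.5 of the paper: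
`E[ℓ_k(ũ_k)|𝒴_{0,k}] ≤ ess inf_{u ∈ 𝕌_{0,k}} E[ℓ_k(u)|𝒴_{0,k}] + 1/k` a.s. for all `k ≥ 1`. -/
def MeanOptimalStrategy (P : Measure Ω) (T S : Ω → Ω) (Y : MeasurableSpace Ω)
    (ℓ : U → Ω → ℝ) (ut : ℕ → Ω → U) : Prop :=
  Admissible T S Y ut ∧
    ∀ k : ℕ, 1 ≤ k → ∃ g : Ω → ℝ,
      IsEssInfFam P (Umn T S Y 0 (k : ℤ))
        (fun v => P[lossAt T S ℓ (k : ℤ) v | obsField T S Y 0 (k : ℤ)]) g ∧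
      ∀ᵐ ω ∂P, (P[lossAt T S ℓ (k : ℤ) (ut k) | obsField T S Y 0 (k : ℤ)]) ω ≤ g ω + (k : ℝ)⁻¹

/-- Pathwise optimality (Definition 2.2). -/
def PathwiseOptimal (P : Measure Ω) (T S : Ω → Ω) (Y : MeasurableSpace Ω)
    (ℓ : U → Ω → ℝ) (us : ℕ → Ω → U) : Prop :=
  Admissible T S Y us ∧
    ∀ u : ℕ → Ω → U, Admissible T S Y u →
      ∀ᵐ ω ∂P,
        0 ≤ Filter.liminf (fun n : ℕ => avgLoss T S ℓ u n ω - avgLoss T S ℓ us n ω) atTop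

/-- Weak pathwise optimality (Definition 2.3). -/
def WeaklyPathwiseOptimal (P : Measure Ω) (T S : Ω → Ω) (Y : MeasurableSpace Ω)
    (ℓ : U → Ω → ℝ) (us : ℕ → Ω → U) : Prop :=
  Admissible T S Y us ∧
    ∀ u : ℕ → Ω → U, Admissible T S Y u → ∀ ε : ℝ, 0 < ε →
      Tendsto (fun n : ℕ => P {ω | -ε ≤ avgLoss T S ℓ u n ω - avgLoss T S ℓ us n ω})
        atTop (𝓝 1)

/-- Mean optimality (Definition 2.4). -/
def MeanOptimal (P : Measure Ω) (T S : Ω → Ω) (Y : MeasurableSpace Ω)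
    (ℓ : U → Ω → ℝ) (us : ℕ → Ω → U) : Prop :=
  Admissible T S Y us ∧
    ∀ u : ℕ → Ω → U, Admissible T S Y u →
      0 ≤ Filter.liminf
        (fun n : ℕ => (∫ ω, avgLoss T S ℓ u n ω ∂P) - ∫ ω, avgLoss T S ℓ us n ω ∂P) atTop

/-- Two σ-fields on `Ω` agree modulo `P`-null sets. -/
def EqModP (P : Measure Ω) (m₁ m₂ : MeasurableSpace Ω) : Prop :=
  (∀ A : Set Ω, MeasurableSet[m₁] A → ∃ B : Set Ω, MeasurableSet[m₂] B ∧ P (A ∆ B) = 0) ∧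
    ∀ A : Set Ω, MeasurableSet[m₂] A → ∃ B : Set Ω, MeasurableSet[m₁] B ∧ P (A ∆ B) = 0

/-- Conditional K-automorphism relative to `Z` (Definition 1.4); `S` is the inverse of `T`,
so that `T^{-k}𝒳 = comap T^k 𝒳` and `T^{k}𝒳 = comap S^k 𝒳`. -/
def CondK (P : Measure Ω) (T S : Ω → Ω) (Z : MeasurableSpace Ω) : Prop :=
  ∃ X : MeasurableSpace Ω, X ≤ m0 ∧
    X ≤ MeasurableSpace.comap T X ∧
    EqModP P (⨆ k : ℕ, MeasurableSpace.comap (T^[k + 1]) X) m0 ∧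
    EqModP P (⨅ k : ℕ, Z ⊔ MeasurableSpace.comap (S^[k + 1]) X) Z

/-- Conditional weak mixing relative to `Z` (Definition 1.3); `S` is the inverse of `T`,
so that `T^k B = (S^[k])⁻¹ B`. -/
def CondWeakMixing (P : Measure Ω) (S : Ω → Ω) (Z : MeasurableSpace Ω) : Prop :=
  ∀ A B : Set Ω, MeasurableSet[m0] A → MeasurableSet[m0] B →
    Tendsto
      (fun n : ℕ => ∫ ω,
        (n : ℝ)⁻¹ * ∑ k ∈ Finset.Icc 1 n,
          |(P[(A ∩ S^[k] ⁻¹' B).indicator (fun _ => (1 : ℝ)) | Z]) ω -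
            (P[A.indicator (fun _ => (1 : ℝ)) | Z]) ω *
              (P[(S^[k] ⁻¹' B).indicator (fun _ => (1 : ℝ)) | Z]) ω| ∂P)
      atTop (𝓝 0)

/-- The tail σ-field `⋂_{k≥1} (𝒴_{-∞,0} ∨ T^k 𝒳)`. -/
def tailField (T S : Ω → Ω) (Y X : MeasurableSpace Ω) : MeasurableSpace Ω :=
  ⨅ k : ℕ, obsFieldLE T S Y 0 ⊔ MeasurableSpace.comap (S^[k + 1]) X

/-- The truncated loss `ℓ_0(v)·1_{Λ ≤ M}`. -/
def truncLoss (ℓ : U → Ω → ℝ) (Λ : Ω → ℝ) (M : ℝ) (v : Ω → U) (ω : Ω) : ℝ :=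
  if Λ ω ≤ M then ℓ (v ω) ω else 0

/-- `ℓ̄_0^M(v) = ℓ_0(v)·1_{Λ≤M} − E[ℓ_0(v)·1_{Λ≤M} | 𝒴_{-∞,0}]`. -/
def barLoss (P : Measure Ω) (T S : Ω → Ω) (Y : MeasurableSpace Ω)
    (ℓ : U → Ω → ℝ) (Λ : Ω → ℝ) (M : ℝ) (v : Ω → U) (ω : Ω) : ℝ :=
  truncLoss ℓ Λ M v ω - (P[truncLoss ℓ Λ M v | obsFieldLE T S Y 0]) ω

/-- The uniform conditional mixing assumption of Theorem 2.12:
`lim_{M→∞} limsup_{T→∞} E[(1/T)∑_{k=1}^T ess sup_{u,u'∈𝕌₀}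
|E[(ℓ̄₀^M(u)∘T^{-k})·ℓ̄₀^M(u')|𝒴_{-∞,0}]|] = 0`. -/
def UniformCondMixing (P : Measure Ω) (T S : Ω → Ω) (Y : MeasurableSpace Ω)
    (ℓ : U → Ω → ℝ) (Λ : Ω → ℝ) : Prop :=
  ∃ G : ℝ → ℕ → Ω → ℝ,
    (∀ (M : ℝ) (k : ℕ),
      IsEssSupFam P ((Un T S Y 0) ×ˢ (Un T S Y 0))
        (fun p ω =>
          |(P[(fun ω' => barLoss P T S Y ℓ Λ M p.1 (S^[k] ω') *
                barLoss P T S Y ℓ Λ M p.2 ω') | obsFieldLE T S Y 0]) ω|)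
        (G M k)) ∧
    Tendsto
      (fun M : ℝ =>
        Filter.limsup
          (fun n : ℕ => ∫ ω, (n : ℝ)⁻¹ * ∑ k ∈ Finset.Icc 1 n, G M k ω ∂P) atTop)
      atTop (𝓝 0)

/-- Equimeasurability of the loss (Definition 3.1): for every `ε > 0` there is a set of
probability at least `1-ε` on which the family `{ℓ(u,·) : u ∈ U}` is totally bounded
in `L^∞(P)`. -/
def Equimeasurable (P : Measure Ω) (ℓ : U → Ω → ℝ) : Prop :=
  ∀ ε : ℝ, 0 < ε → ∃ Ωε : Set Ω, MeasurableSet[m0] Ωε ∧ 1 - ENNReal.ofReal ε ≤ P Ωε ∧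
    ∀ δ : ℝ, 0 < δ → ∃ 𝒩 : Finset (Ω → ℝ), ∀ u : U, ∃ f ∈ 𝒩,
      eLpNorm (fun ω => Ωε.indicator (ℓ u) ω - f ω) ⊤ P ≤ ENNReal.ofReal δ


section helpers

lemma integral_comp_mp {P : Measure Ω} {τ : Ω → Ω}
    (hτ : MeasurePreserving τ P P) {f : Ω → ℝ} (hf : AEStronglyMeasurable f P) :
    ∫ ω, f (τ ω) ∂P = ∫ ω, f ω ∂P := by
  have h := integral_map (μ := P) hτ.measurable.aemeasurable (f := f) (by rwa [hτ.map_eq])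
  rw [hτ.map_eq] at h
  exact h.symm

lemma condExp_comp_mp {Ω : Type*} {Z m0 : MeasurableSpace Ω} {P : Measure Ω} [IsProbabilityMeasure P] {τ : Ω → Ω}
    (hτ : MeasurePreserving τ P P)  (hZ : Z ≤ m0) {f : Ω → ℝ}
    (hf : Integrable f P) :
    P[fun ω => f (τ ω) | MeasurableSpace.comap τ Z] =ᵐ[P] fun ω => (P[f | Z]) (τ ω) := by
  have hle : MeasurableSpace.comap τ Z ≤ m0 := by
    rintro s ⟨t, ht, rfl⟩
    exact hτ.measurable (hZ t ht)
  have hset : ∀ (φ : Ω → ℝ), Integrable φ P → ∀ t, MeasurableSet t →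
      ∫ ω in τ ⁻¹' t, φ (τ ω) ∂P = ∫ ω in t, φ ω ∂P := by
    intro φ hφ t ht
    have h := setIntegral_map (μ := P) ht (f := φ) (g := τ) (by rw [hτ.map_eq]; exact hφ.1)
      hτ.measurable.aemeasurable
    rw [hτ.map_eq] at h
    exact h.symm
  symm
  refine ae_eq_condExp_of_forall_setIntegral_eq hle (hτ.integrable_comp_of_integrable hf) ?_ ?_ ?_
  · intro s _ _
    exact (hτ.integrable_comp_of_integrable integrable_condExp).integrableOn
  · rintro s ⟨t, ht, rfl⟩ _
    rw [hset _ integrable_condExp t (hZ t ht), hset _ hf t (hZ t ht)]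
    exact setIntegral_condExp hZ hf ht
  · have h1 : Measurable[Z] (P[f | Z]) := stronglyMeasurable_condExp.measurable
    have h2 : Measurable[MeasurableSpace.comap τ Z] (fun ω => (P[f | Z]) (τ ω)) :=
      h1.comp (comap_measurable τ)
    exact h2.stronglyMeasurable.aestronglyMeasurable

lemma measurable_inv {Ω : Type*} {Z : MeasurableSpace Ω} {T S : Ω → Ω} (hTS : Function.RightInverse S T)
     (hZT : Z ≤ MeasurableSpace.comap T Z) : Measurable[Z, Z] S := by
  intro A hA
  obtain ⟨A', hA', rfl⟩ := hZT A hA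
  have : S ⁻¹' (T ⁻¹' A') = A' := by
    ext x; simp [hTS x]
  rw [this]; exact hA'

lemma measurable_inv_iter {Ω : Type*} {Z : MeasurableSpace Ω} {T S : Ω → Ω} (hTS : Function.RightInverse S T)
     (hZT : Z ≤ MeasurableSpace.comap T Z) (i : ℕ) :
    Measurable[Z, Z] (S^[i]) := by
  induction i with
  | zero => exact measurable_id
  | succ n ih => rw [Function.iterate_succ]; exact ih.comp (measurable_inv hTS hZT)

/-- the conditional covariance appearing in the weak mixing condition -/
def cov (P : Measure Ω) (S : Ω → Ω) (Z : MeasurableSpace Ω) (B : Set Ω) (k : ℕ) (ω : Ω) : ℝ :=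
  (P[(B ∩ S^[k] ⁻¹' B).indicator (fun _ => (1 : ℝ)) | Z]) ω -
            (P[B.indicator (fun _ => (1 : ℝ)) | Z]) ω *
              (P[(S^[k] ⁻¹' B).indicator (fun _ => (1 : ℝ)) | Z]) ω

lemma integral_mul_condExp {Ω : Type*} {Z m0 : MeasurableSpace Ω} {P : Measure Ω} [IsProbabilityMeasure P] 
    (hZ : Z ≤ m0) {b φ : Ω → ℝ} (hb : Measurable[Z] b) {C : ℝ} (hbC : ∀ ω, |b ω| ≤ C)
    (hφ : Integrable φ P) :
    ∫ ω, b ω * φ ω ∂P = ∫ ω, b ω * (P[φ | Z]) ω ∂P := by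
  have hint : Integrable (fun ω => b ω * φ ω) P :=
    hφ.bdd_mul (c := C) (hb.mono hZ le_rfl).aestronglyMeasurable (ae_of_all _ hbC)
  rw [← integral_condExp hZ (f := fun ω => b ω * φ ω)]
  exact integral_congr_ae
    (condExp_mul_of_stronglyMeasurable_left hb.stronglyMeasurable hint hφ)

lemma integrable_of_bdd {P : Measure Ω} [IsProbabilityMeasure P] {f : Ω → ℝ} (hf : Measurable f)
    (C : ℝ) (h : ∀ ω, |f ω| ≤ C) : Integrable f P :=
  Integrable.of_bound hf.aestronglyMeasurable C (ae_of_all _ h)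

lemma cov_bound {Ω : Type*} {Z m0 : MeasurableSpace Ω} {P : Measure Ω} [IsProbabilityMeasure P] {T S : Ω → Ω}
    (hS : MeasurePreserving S P P) (hTS : Function.RightInverse S T)
     (hZ : Z ≤ m0) (hZT : Z ≤ MeasurableSpace.comap T Z)
    {B : Set Ω} (hB : MeasurableSet B) {g : Ω → ℝ} (hg : Measurable[Z] g)
    (hg0 : ∀ ω, 0 ≤ g ω) (hg1 : ∀ ω, g ω ≤ 1)
    (hgB : g =ᵐ[P] P[B.indicator (fun _ => (1 : ℝ)) | Z])
    {b : Ω → ℝ} (hb : Measurable[Z] b) (hb1 : ∀ ω, |b ω| ≤ 1) (i : ℕ) :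
    ∫ ω, b ω * ((B.indicator (fun _ => (1 : ℝ)) ω - g ω) *
      (B.indicator (fun _ => (1 : ℝ)) (S^[i] ω) - g (S^[i] ω))) ∂P
      ≤ ∫ ω, |cov P S Z B i ω| ∂P := by
  have hSi := measurable_inv_iter hTS hZT i
  have hSim : Measurable (S^[i]) := (hS.iterate i).measurable
  have hB' : MeasurableSet (S^[i] ⁻¹' B) := hSim hB
  set f : Ω → ℝ := B.indicator (fun _ => (1 : ℝ)) with hf
  set f' : Ω → ℝ := (S^[i] ⁻¹' B).indicator (fun _ => (1 : ℝ)) with hf'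
  set ff : Ω → ℝ := (B ∩ S^[i] ⁻¹' B).indicator (fun _ => (1 : ℝ)) with hff
  have hgs : Measurable[Z] (fun ω => g (S^[i] ω)) := hg.comp hSi
  have hgabs : ∀ ω, |g ω| ≤ 1 := fun ω => abs_le.2 ⟨by linarith [hg0 ω], hg1 ω⟩
  have ind1 : ∀ (A : Set Ω) ω, |A.indicator (fun _ => (1 : ℝ)) ω| ≤ 1 := by
    intro A ω
    by_cases h : ω ∈ A <;> simp [h]
  have hfI : Integrable f P := integrable_of_bdd (measurable_const.indicator hB) 1 (ind1 _)
  have hfI' : Integrable f' P := integrable_of_bdd (measurable_const.indicator hB') 1 (ind1 _)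
  have hffI : Integrable ff P :=
    integrable_of_bdd (measurable_const.indicator (hB.inter hB')) 1 (ind1 _)
  have hm2 : ∀ {x y : ℝ}, |x| ≤ 1 → |y| ≤ 1 → |x * y| ≤ 1 := by
    intro x y hx hy
    rw [abs_mul]; exact mul_le_one₀ hx (abs_nonneg _) hy
  have hbg : Measurable[Z] (fun ω => b ω * g ω) := hb.mul hg
  have hbgs : Measurable[Z] (fun ω => b ω * g (S^[i] ω)) := hb.mul hgs
  have e1 := integral_mul_condExp hZ hb hb1 hffI
  have e2 := integral_mul_condExp hZ hbg (fun ω => hm2 (hb1 ω) (hgabs ω)) hfI'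
  have e3 := integral_mul_condExp hZ hbgs (fun ω => hm2 (hb1 ω) (hgabs _)) hfI
  have i1 : Integrable (fun ω => b ω * ff ω) P :=
    hffI.bdd_mul (c := 1) (hb.mono hZ le_rfl).aestronglyMeasurable (ae_of_all _ hb1)
  have i2 : Integrable (fun ω => b ω * g ω * f' ω) P :=
    hfI'.bdd_mul (c := 1) (hbg.mono hZ le_rfl).aestronglyMeasurable
      (ae_of_all _ fun ω => hm2 (hb1 ω) (hgabs ω))
  have i3 : Integrable (fun ω => b ω * g (S^[i] ω) * f ω) P :=
    hfI.bdd_mul (c := 1) (hbgs.mono hZ le_rfl).aestronglyMeasurable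
      (ae_of_all _ fun ω => hm2 (hb1 ω) (hgabs _))
  have i4 : Integrable (fun ω => b ω * g (S^[i] ω) * g ω) P :=
    integrable_of_bdd ((hbgs.mul hg).mono hZ le_rfl) 1
      (fun ω => hm2 (hm2 (hb1 ω) (hgabs _)) (hgabs _))
  have j1 : Integrable (fun ω => b ω * (P[ff | Z]) ω) P :=
    integrable_condExp.bdd_mul (c := 1) (hb.mono hZ le_rfl).aestronglyMeasurable (ae_of_all _ hb1)
  have j2 : Integrable (fun ω => b ω * g ω * (P[f' | Z]) ω) P :=
    integrable_condExp.bdd_mul (c := 1) (hbg.mono hZ le_rfl).aestronglyMeasurable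
      (ae_of_all _ fun ω => hm2 (hb1 ω) (hgabs ω))
  have expand : ∀ ω, b ω * ((f ω - g ω) * (f (S^[i] ω) - g (S^[i] ω)))
      = b ω * ff ω - b ω * g ω * f' ω - b ω * g (S^[i] ω) * f ω + b ω * g (S^[i] ω) * g ω := by
    intro ω
    have h1 : f (S^[i] ω) = f' ω := rfl
    have h2 : ff ω = f ω * f' ω := by
      simp only [hff, hf, hf']
      by_cases hx : ω ∈ B <;> by_cases hy : S^[i] ω ∈ B <;> simp [hx, hy]
    rw [h1, h2]; ring
  have e3' : ∫ ω, b ω * g (S^[i] ω) * (P[f | Z]) ω ∂P = ∫ ω, b ω * g (S^[i] ω) * g ω ∂P := by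
    refine integral_congr_ae ?_
    filter_upwards [hgB] with ω hω
    rw [hω]
  have covI : Integrable (fun ω => b ω * (P[ff | Z]) ω - b ω * g ω * (P[f' | Z]) ω) P := j1.sub j2
  have covE : (fun ω => b ω * (P[ff | Z]) ω - b ω * g ω * (P[f' | Z]) ω)
      =ᵐ[P] fun ω => b ω * cov P S Z B i ω := by
    filter_upwards [hgB] with ω hω
    simp only [cov]
    rw [hω]; ring
  have covInt : Integrable (cov P S Z B i) P := by
    have h : Integrable (fun ω => (P[ff | Z]) ω - g ω * (P[f' | Z]) ω) P :=
      integrable_condExp.sub (integrable_condExp.bdd_mul (c := 1)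
        (hg.mono hZ le_rfl).aestronglyMeasurable (ae_of_all _ hgabs))
    refine h.congr ?_
    filter_upwards [hgB] with ω hω
    simp only [cov]
    rw [hω]
  calc _ = ∫ ω, (b ω * ff ω - b ω * g ω * f' ω - b ω * g (S^[i] ω) * f ω
          + b ω * g (S^[i] ω) * g ω) ∂P := by
        refine integral_congr_ae (ae_of_all _ fun ω => expand ω)
    _ = ∫ ω, b ω * (P[ff | Z]) ω ∂P - ∫ ω, b ω * g ω * (P[f' | Z]) ω ∂P := by
        have i12 : Integrable (fun ω => b ω * ff ω - b ω * g ω * f' ω) P := i1.sub i2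
        have i123 : Integrable (fun ω => b ω * ff ω - b ω * g ω * f' ω
          - b ω * g (S^[i] ω) * f ω) P := i12.sub i3
        rw [integral_add i123 i4, integral_sub i12 i3, integral_sub i1 i2,
          e1, e2, e3, e3']
        ring
    _ = ∫ ω, b ω * cov P S Z B i ω ∂P := by
        rw [← integral_sub j1 j2]; exact integral_congr_ae covE
    _ ≤ _ := by
        refine integral_mono_ae (covI.congr covE) covInt.abs (ae_of_all _ fun ω => ?_)
        calc b ω * cov P S Z B i ω ≤ |b ω * cov P S Z B i ω| := le_abs_self _
          _ = |b ω| * |cov P S Z B i ω| := abs_mul _ _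
          _ ≤ 1 * |cov P S Z B i ω| := by gcongr; exact hb1 ω
          _ = _ := one_mul _

lemma cov_integrable {Ω : Type*} {Z m0 : MeasurableSpace Ω} {P : Measure Ω}
    [IsProbabilityMeasure P] (S : Ω → Ω) (B : Set Ω) (i : ℕ) : Integrable (cov P S Z B i) P := by
  have hb : ∀ᵐ ω ∂P, |(P[B.indicator (fun _ => (1 : ℝ)) | Z]) ω| ≤ 1 := by
    refine ae_bdd_abs_condExp_of_ae_bdd_abs (ae_of_all _ fun ω => ?_)
    by_cases h : ω ∈ B <;> simp [h]
  exact integrable_condExp.sub (integrable_condExp.bdd_mul (c := 1)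
    integrable_condExp.1 hb)

lemma measurable_pull {Ω : Type*} {Z : MeasurableSpace Ω} {T S : Ω → Ω}
    (hTS : Function.RightInverse S T) (k : ℕ) {a : Ω → ℝ}
    (ha : Measurable[MeasurableSpace.comap (T^[k]) Z] a) :
    Measurable[Z] (fun ω => a (S^[k] ω)) := by
  intro s hs
  obtain ⟨t, ht, hts⟩ := ha hs
  have : (fun ω => a (S^[k] ω)) ⁻¹' s = t := by
    change S^[k] ⁻¹' (a ⁻¹' s) = t
    rw [← hts]
    ext x
    simp [(Function.RightInverse.iterate hTS k) x]
  rw [this]; exact ht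

lemma comap_iter_mono {Ω : Type*} {Z : MeasurableSpace Ω} {T : Ω → Ω}
    (hZT : Z ≤ MeasurableSpace.comap T Z) {j k : ℕ} (hjk : j ≤ k) :
    MeasurableSpace.comap (T^[j]) Z ≤ MeasurableSpace.comap (T^[k]) Z := by
  induction k, hjk using Nat.le_induction with
  | base => exact le_rfl
  | succ n _ ih =>
    refine ih.trans ?_
    rw [Function.iterate_succ', ← MeasurableSpace.comap_comp]
    exact MeasurableSpace.comap_mono hZT

lemma cross_moment {Ω : Type*} {Z m0 : MeasurableSpace Ω} {P : Measure Ω}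
    [IsProbabilityMeasure P] {T S : Ω → Ω} (hT : MeasurePreserving T P P)
    (hS : MeasurePreserving S P P) (hTS : Function.RightInverse S T)
    (hZ : Z ≤ m0) (hZT : Z ≤ MeasurableSpace.comap T Z)
    {B : Set Ω} (hB : MeasurableSet B) {g : Ω → ℝ} (hg : Measurable[Z] g)
    (hg0 : ∀ ω, 0 ≤ g ω) (hg1 : ∀ ω, g ω ≤ 1)
    (hgB : g =ᵐ[P] P[B.indicator (fun _ => (1 : ℝ)) | Z])
    {a : ℕ → Ω → ℝ} (ha : ∀ k, 1 ≤ k → Measurable[MeasurableSpace.comap (T^[k]) Z] (a k))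
    (ha1 : ∀ k ω, |a k ω| ≤ 1) {h : Ω → ℝ}
    (hh : h = fun ω => B.indicator (fun _ => (1 : ℝ)) ω - g ω)
    {j k : ℕ} (hj : 1 ≤ j) (hjk : j ≤ k) :
    ∫ ω, (a j ω * h (T^[j] ω)) * (a k ω * h (T^[k] ω)) ∂P
      ≤ ∫ ω, |cov P S Z B (k - j) ω| ∂P := by
  have hle : ∀ k, MeasurableSpace.comap (T^[k]) Z ≤ m0 := by
    rintro k s ⟨t, ht, rfl⟩
    exact (hT.iterate k).measurable (hZ t ht)
  have ham : ∀ k, 1 ≤ k → Measurable (a k) := fun k hk => (ha k hk).mono (hle k) le_rfl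
  have hhm : Measurable h := by
    rw [hh]; exact (measurable_const.indicator hB).sub (hg.mono hZ le_rfl)
  have hTk := fun k => (hT.iterate k).measurable
  have haj : Measurable[MeasurableSpace.comap (T^[k]) Z] (a j) :=
    (ha j hj).mono (comap_iter_mono hZT hjk) le_rfl
  have b1 : Measurable[Z] (fun ω => a j (S^[k] ω) * a k (S^[k] ω)) :=
    (measurable_pull hTS k haj).mul (measurable_pull hTS k (ha k (hj.trans hjk)))
  have key := cov_bound hS hTS hZ hZT hB hg hg0 hg1 hgB b1 (fun ω => by
    rw [abs_mul]; exact mul_le_one₀ (ha1 _ _) (abs_nonneg _) (ha1 _ _)) (k - j)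
  refine le_trans (le_of_eq ?_) key
  rw [← integral_comp_mp (hS.iterate k)
    (f := fun ω => (a j ω * h (T^[j] ω)) * (a k ω * h (T^[k] ω)))
    ((((ham j hj).mul (hhm.comp (hTk j))).mul
      ((ham k (hj.trans hjk)).mul (hhm.comp (hTk k)))).aestronglyMeasurable)]
  refine integral_congr_ae (ae_of_all _ fun ω => ?_)
  have e1 : T^[k] (S^[k] ω) = ω := Function.RightInverse.iterate hTS k ω
  have e2 : T^[j] (S^[k] ω) = S^[k - j] ω := by
    conv_lhs => rw [show k = j + (k - j) by omega, Function.iterate_add_apply]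
    exact Function.RightInverse.iterate hTS j _
  simp only [e1, e2, hh]
  ring

lemma second_moment {Ω : Type*} {m0 : MeasurableSpace Ω} {P : Measure Ω}
    [IsProbabilityMeasure P] {x : ℕ → Ω → ℝ} (hx : ∀ k, 1 ≤ k → Measurable (x k))
    (hx1 : ∀ k ω, |x k ω| ≤ 1) {ρ : ℕ → ℝ} (hρ : ∀ i, 0 ≤ ρ i)
    (hc : ∀ j k, 1 ≤ j → j ≤ k → ∫ ω, x j ω * x k ω ∂P ≤ ρ (k - j)) (n : ℕ) :
    ∫ ω, (∑ k ∈ Finset.Icc 1 n, x k ω) ^ 2 ∂P ≤ 2 * n * ∑ i ∈ Finset.range n, ρ i := by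
  induction n with
  | zero => simp
  | succ n ih =>
    have hxy : ∀ j k, 1 ≤ j → 1 ≤ k → Integrable (fun ω => x j ω * x k ω) P := fun j k hj hk =>
      integrable_of_bdd ((hx j hj).mul (hx k hk)) 1 (fun ω => by
        rw [abs_mul]; exact mul_le_one₀ (hx1 _ _) (abs_nonneg _) (hx1 _ _))
    have hsm : Measurable (fun ω => ∑ k ∈ Finset.Icc 1 n, x k ω) :=
      Finset.measurable_sum _ (fun k hk => hx k (Finset.mem_Icc.1 hk).1)
    have hsb : ∀ ω, |∑ k ∈ Finset.Icc 1 n, x k ω| ≤ n := fun ω => by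
      refine (Finset.abs_sum_le_sum_abs _ _).trans ?_
      refine (Finset.sum_le_sum (fun k _ => hx1 k ω)).trans ?_
      simp
    have hs2 : Integrable (fun ω => (∑ k ∈ Finset.Icc 1 n, x k ω) ^ 2) P :=
      integrable_of_bdd (hsm.pow_const 2) ((n : ℝ) ^ 2) (fun ω => by
        rw [abs_pow]; exact pow_le_pow_left₀ (abs_nonneg _) (hsb ω) 2)
    have hcr : Integrable (fun ω => ∑ k ∈ Finset.Icc 1 n, x k ω * x (n + 1) ω) P :=
      integrable_finsetSum _ (fun k hk => hxy k _ (Finset.mem_Icc.1 hk).1 (by omega))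
    have hcr2 : Integrable (fun ω => 2 * ∑ k ∈ Finset.Icc 1 n, x k ω * x (n + 1) ω) P :=
      hcr.const_mul 2
    have hadd : Integrable (fun ω => (∑ k ∈ Finset.Icc 1 n, x k ω) ^ 2
        + 2 * ∑ k ∈ Finset.Icc 1 n, x k ω * x (n + 1) ω) P := hs2.add hcr2
    have hexp : ∀ ω, (∑ k ∈ Finset.Icc 1 (n + 1), x k ω) ^ 2
        = (∑ k ∈ Finset.Icc 1 n, x k ω) ^ 2 + 2 * ∑ k ∈ Finset.Icc 1 n, x k ω * x (n + 1) ω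
          + x (n + 1) ω * x (n + 1) ω := by
      intro ω
      rw [Finset.sum_Icc_succ_top (by omega), ← Finset.sum_mul]
      ring
    have hcross : ∫ ω, ∑ k ∈ Finset.Icc 1 n, x k ω * x (n + 1) ω ∂P
        ≤ ∑ i ∈ Finset.range n, ρ (i + 1) := by
      rw [integral_finsetSum _ (fun k hk => hxy k _ (Finset.mem_Icc.1 hk).1 (by omega))]
      calc _ ≤ ∑ k ∈ Finset.Icc 1 n, ρ (n + 1 - k) := Finset.sum_le_sum (fun k hk => by
            have := Finset.mem_Icc.1 hk
            exact hc k (n + 1) this.1 (by omega))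
        _ = ∑ i ∈ Finset.range n, ρ (i + 1) := by
            refine Finset.sum_nbij' (fun k => n - k) (fun i => n - i) ?_ ?_ ?_ ?_ ?_
            · intro k hk; simp at hk ⊢; omega
            · intro k hk; simp at hk ⊢; omega
            · intro k hk; simp at hk ⊢; omega
            · intro k hk; simp at hk ⊢; omega
            · intro k hk; simp at hk
              rw [show n + 1 - k = n - k + 1 by omega]
    have hdiag : ∫ ω, x (n + 1) ω * x (n + 1) ω ∂P ≤ ρ 0 := by
      simpa using hc (n + 1) (n + 1) (by omega) le_rfl
    have hr : ∑ i ∈ Finset.range (n + 1), ρ i = ∑ i ∈ Finset.range n, ρ (i + 1) + ρ 0 :=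
      Finset.sum_range_succ' _ _
    have hr2 : ∑ i ∈ Finset.range (n + 1), ρ i = ∑ i ∈ Finset.range n, ρ i + ρ n :=
      Finset.sum_range_succ _ _
    simp_rw [hexp]
    rw [integral_add hadd (hxy _ _ (by omega) (by omega)), integral_add hs2 hcr2,
      integral_const_mul]
    have : (2 * (n : ℝ)) * ∑ i ∈ Finset.range n, ρ i
        ≤ 2 * n * ∑ i ∈ Finset.range (n + 1), ρ i := by
      rw [hr2]
      have : (0 : ℝ) ≤ 2 * n * ρ n := by have := hρ n; positivity
      nlinarith
    push_cast
    nlinarith [hρ 0]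

lemma tendsto_integral_abs_of_sq {Ω : Type*} {m0 : MeasurableSpace Ω} {P : Measure Ω}
    [IsProbabilityMeasure P] {X : ℕ → Ω → ℝ} (hX : ∀ n, Integrable (X n) P)
    (hX2 : ∀ n, Integrable (fun ω => X n ω ^ 2) P)
    (h : Tendsto (fun n => ∫ ω, X n ω ^ 2 ∂P) atTop (𝓝 0)) :
    Tendsto (fun n => ∫ ω, |X n ω| ∂P) atTop (𝓝 0) := by
  have h1 : Tendsto (fun n => √(∫ ω, X n ω ^ 2 ∂P)) atTop (𝓝 0) := by
    simpa using h.sqrt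
  refine squeeze_zero (fun n => integral_nonneg fun ω => abs_nonneg _) (fun n => ?_) h1
  refine Real.le_sqrt_of_sq_le ?_
  have hv := ProbabilityTheory.variance_nonneg (fun ω => |X n ω|) P
  rw [ProbabilityTheory.variance_eq_sub] at hv
  · simp only [Pi.pow_def, sq_abs] at hv
    linarith
  · rw [memLp_two_iff_integrable_sq (hX n).abs.1]
    simpa using hX2 n

lemma cesaro_cov {Ω : Type*} {Z m0 : MeasurableSpace Ω} {P : Measure Ω}
    [IsProbabilityMeasure P] {S : Ω → Ω} (hWM : CondWeakMixing P S Z) {B : Set Ω}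
    (hB : MeasurableSet B) :
    Tendsto (fun n : ℕ => (n : ℝ)⁻¹ * ∑ i ∈ Finset.range n, ∫ ω, |cov P S Z B i ω| ∂P)
      atTop (𝓝 0) := by
  have h := hWM B B hB hB
  have h0 : Tendsto (fun n : ℕ => (n : ℝ)⁻¹ * ∫ ω, |cov P S Z B 0 ω| ∂P) atTop (𝓝 0) := by
    simpa using (tendsto_inv_atTop_nhds_zero_nat (𝕜 := ℝ)).mul_const _
  have h2 := h0.add h
  rw [add_zero] at h2
  refine squeeze_zero (fun n => ?_) (fun n => ?_) h2
  · have : 0 ≤ ∑ i ∈ Finset.range n, ∫ ω, |cov P S Z B i ω| ∂P :=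
      Finset.sum_nonneg fun i _ => integral_nonneg fun ω => abs_nonneg _
    positivity
  · change _ ≤ _ + ∫ ω, (n : ℝ)⁻¹ * ∑ k ∈ Finset.Icc 1 n, |cov P S Z B k ω| ∂P
    rw [integral_const_mul, integral_finsetSum _ (fun k _ => (cov_integrable S B k).abs),
      ← mul_add]
    refine mul_le_mul_of_nonneg_left ?_ (by positivity)
    have hsub : Finset.range n ⊆ insert 0 (Finset.Icc 1 n) := by
      intro i hi; simp at hi ⊢; omega
    calc _ ≤ ∑ i ∈ insert 0 (Finset.Icc 1 n), ∫ ω, |cov P S Z B i ω| ∂P :=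
          Finset.sum_le_sum_of_subset_of_nonneg hsub
            (fun i _ _ => integral_nonneg fun ω => abs_nonneg _)
      _ = _ := Finset.sum_insert (by simp)

/-- weighted ergodic average of the centred function -/
def wavg (P : Measure Ω) (T : Ω → Ω) (Z : MeasurableSpace Ω) (a : ℕ → Ω → ℝ) (f : Ω → ℝ)
    (n : ℕ) (ω : Ω) : ℝ :=
  (n : ℝ)⁻¹ * ∑ k ∈ Finset.Icc 1 n, a k ω * (f (T^[k] ω) - (P[f | Z]) (T^[k] ω))

section wavg

variable {Ω : Type*} {Z m0 : MeasurableSpace Ω} {P : Measure Ω}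
    [IsProbabilityMeasure P] {T S : Ω → Ω}

lemma ae_iter (hT : MeasurePreserving T P P) {p : Ω → Prop} (hp : ∀ᵐ ω ∂P, p ω) :
    ∀ᵐ ω ∂P, ∀ k : ℕ, p (T^[k] ω) :=
  ae_all_iff.2 fun k => (hT.iterate k).quasiMeasurePreserving.ae hp

lemma wavg_term_integrable (hT : MeasurePreserving T P P) {a : ℕ → Ω → ℝ}
    (ha : ∀ k, 1 ≤ k → Measurable (a k)) (ha1 : ∀ k ω, |a k ω| ≤ 1) {h : Ω → ℝ}
    (hh : Integrable h P) {k : ℕ} (hk : 1 ≤ k) :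
    Integrable (fun ω => a k ω * h (T^[k] ω)) P :=
  ((hT.iterate k).integrable_comp_of_integrable hh).bdd_mul (c := 1)
    (ha k hk).aestronglyMeasurable (ae_of_all _ (ha1 k))

lemma wavg_integrable (hT : MeasurePreserving T P P) {a : ℕ → Ω → ℝ}
    (ha : ∀ k, 1 ≤ k → Measurable (a k)) (ha1 : ∀ k ω, |a k ω| ≤ 1) {f : Ω → ℝ}
    (hf : Integrable f P) (n : ℕ) : Integrable (wavg P T Z a f n) P :=
  (integrable_finsetSum _ fun k hk => wavg_term_integrable hT ha ha1
    (hf.sub (integrable_condExp (m := Z) (f := f))) (Finset.mem_Icc.1 hk).1).const_mul _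

lemma wavg_add (hT : MeasurePreserving T P P) (a : ℕ → Ω → ℝ) {f g : Ω → ℝ}
    (hf : Integrable f P) (hg : Integrable g P) (n : ℕ) :
    wavg P T Z a (f + g) n =ᵐ[P] fun ω => wavg P T Z a f n ω + wavg P T Z a g n ω := by
  filter_upwards [ae_iter hT (condExp_add hf hg Z)] with ω hω
  simp only [wavg]
  rw [← mul_add, ← Finset.sum_add_distrib]
  congr 1
  refine Finset.sum_congr rfl fun k _ => ?_
  rw [hω k]
  simp only [Pi.add_apply]
  ring

lemma wavg_congr (hT : MeasurePreserving T P P) (a : ℕ → Ω → ℝ) {f g : Ω → ℝ}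
    (hfg : f =ᵐ[P] g) (n : ℕ) :
    wavg P T Z a f n =ᵐ[P] wavg P T Z a g n := by
  filter_upwards [ae_iter hT hfg, ae_iter hT (condExp_congr_ae (m := Z) hfg)] with ω h1 h2
  simp only [wavg, h1, h2]

lemma wavg_smul (hT : MeasurePreserving T P P) (a : ℕ → Ω → ℝ) (c : ℝ) (f : Ω → ℝ) (n : ℕ) :
    wavg P T Z a (c • f) n =ᵐ[P] fun ω => c * wavg P T Z a f n ω := by
  filter_upwards [ae_iter hT (condExp_smul c f Z)] with ω hω
  simp only [wavg]
  simp only [Finset.mul_sum]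
  refine Finset.sum_congr rfl fun k _ => ?_
  rw [hω k]
  simp only [Pi.smul_apply, smul_eq_mul]
  ring

/-- L¹ bound for weighted averages -/
lemma avg_L1_bound {y : ℕ → Ω → ℝ} (hy : ∀ k, 1 ≤ k → Integrable (y k) P) (n : ℕ) :
    ∫ ω, |(n : ℝ)⁻¹ * ∑ k ∈ Finset.Icc 1 n, y k ω| ∂P
      ≤ (n : ℝ)⁻¹ * ∑ k ∈ Finset.Icc 1 n, ∫ ω, |y k ω| ∂P := by
  rw [← integral_finsetSum _ (fun k hk => (hy k (Finset.mem_Icc.1 hk).1).abs),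
    ← integral_const_mul]
  refine integral_mono_ae ?_ ?_ (ae_of_all _ fun ω => ?_)
  · exact ((integrable_finsetSum _ fun k hk => hy k (Finset.mem_Icc.1 hk).1).const_mul _).abs
  · exact ((integrable_finsetSum _ fun k hk => (hy k (Finset.mem_Icc.1 hk).1).abs).const_mul _)
  · simp only
    rw [abs_mul, abs_of_nonneg (by positivity : (0 : ℝ) ≤ (n : ℝ)⁻¹)]
    exact mul_le_mul_of_nonneg_left (Finset.abs_sum_le_sum_abs _ _) (by positivity)

lemma wavg_bound (hT : MeasurePreserving T P P) {a : ℕ → Ω → ℝ}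
    (ha : ∀ k, 1 ≤ k → Measurable (a k)) (ha1 : ∀ k ω, |a k ω| ≤ 1) {f : Ω → ℝ}
    (hf : Integrable f P) (n : ℕ) : ∫ ω, |wavg P T Z a f n ω| ∂P ≤ 2 * ∫ ω, |f ω| ∂P := by
  have hI := hf.sub (integrable_condExp (μ := P) (m := Z) (f := f))
  have hnn : 0 ≤ ∫ ω, |f ω| ∂P := integral_nonneg fun ω => abs_nonneg _
  have hone : ∀ k, 1 ≤ k → ∫ ω, |a k ω * (f (T^[k] ω) - (P[f | Z]) (T^[k] ω))| ∂P
      ≤ 2 * ∫ ω, |f ω| ∂P := by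
    intro k hk
    calc _ ≤ ∫ ω, |f (T^[k] ω) - (P[f | Z]) (T^[k] ω)| ∂P := by
          refine integral_mono_ae (wavg_term_integrable hT ha ha1 hI hk).abs
            ((hT.iterate k).integrable_comp_of_integrable hI).abs (ae_of_all _ fun ω => ?_)
          simp only
          rw [abs_mul]
          exact mul_le_of_le_one_left (abs_nonneg _) (ha1 k ω)
      _ = ∫ ω, |f ω - (P[f | Z]) ω| ∂P :=
          integral_comp_mp (hT.iterate k) (f := fun ω => |f ω - (P[f | Z]) ω|) hI.abs.1
      _ ≤ ∫ ω, (|f ω| + |(P[f | Z]) ω|) ∂P :=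
          integral_mono hI.abs (hf.abs.add integrable_condExp.abs) (fun ω => abs_sub _ _)
      _ = ∫ ω, |f ω| ∂P + ∫ ω, |(P[f | Z]) ω| ∂P := integral_add hf.abs integrable_condExp.abs
      _ ≤ _ := by linarith [integral_abs_condExp_le (μ := P) (m := Z) f]
  refine (avg_L1_bound (fun k hk => wavg_term_integrable hT ha ha1 hI hk) n).trans ?_
  calc _ ≤ (n : ℝ)⁻¹ * ∑ k ∈ Finset.Icc 1 n, 2 * ∫ ω, |f ω| ∂P :=
        mul_le_mul_of_nonneg_left
          (Finset.sum_le_sum fun k hk => hone k (Finset.mem_Icc.1 hk).1) (by positivity)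
    _ = ((n : ℝ)⁻¹ * n) * (2 * ∫ ω, |f ω| ∂P) := by simp; ring
    _ ≤ 1 * (2 * ∫ ω, |f ω| ∂P) := by
        refine mul_le_mul_of_nonneg_right ?_ (by positivity)
        exact inv_mul_le_one
    _ = _ := one_mul _

lemma wavg_indicator (hT : MeasurePreserving T P P)
    (hS : MeasurePreserving S P P) (hTS : Function.RightInverse S T)
    (hZ : Z ≤ m0) (hZT : Z ≤ MeasurableSpace.comap T Z) (hWM : CondWeakMixing P S Z)
    {a : ℕ → Ω → ℝ} (ha : ∀ k, 1 ≤ k → Measurable[MeasurableSpace.comap (T^[k]) Z] (a k))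
    (ha1 : ∀ k ω, |a k ω| ≤ 1) {B : Set Ω} (hB : MeasurableSet B) :
    Tendsto (fun n => ∫ ω, |wavg P T Z a (B.indicator fun _ => (1 : ℝ)) n ω| ∂P)
      atTop (𝓝 0) := by
  set f : Ω → ℝ := B.indicator fun _ => (1 : ℝ) with hf
  have hf0 : ∀ ω, 0 ≤ f ω ∧ f ω ≤ 1 := fun ω => by
    by_cases h : ω ∈ B <;> simp [hf, h]
  have hfm : Measurable f := measurable_const.indicator hB
  have hle : ∀ k, MeasurableSpace.comap (T^[k]) Z ≤ m0 := by
    rintro k s ⟨t, ht, rfl⟩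
    exact (hT.iterate k).measurable (hZ t ht)
  have ham : ∀ k, 1 ≤ k → Measurable (a k) := fun k hk => (ha k hk).mono (hle k) le_rfl
  have hfI : Integrable f P := integrable_of_bdd hfm 1 fun ω => by
    rw [abs_of_nonneg (hf0 ω).1]; exact (hf0 ω).2
  set g : Ω → ℝ := fun ω => max 0 (min 1 ((P[f | Z]) ω)) with hgdef
  have hg : Measurable[Z] g :=
    measurable_const.max (measurable_const.min stronglyMeasurable_condExp.measurable)
  have hg0 : ∀ ω, 0 ≤ g ω := fun ω => le_max_left _ _
  have hg1 : ∀ ω, g ω ≤ 1 := fun ω => max_le zero_le_one (min_le_left _ _)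
  have hgB : g =ᵐ[P] P[f | Z] := by
    have h0 : 0 ≤ᵐ[P] P[f | Z] := condExp_nonneg (ae_of_all _ fun ω => (hf0 ω).1)
    have h1 : ∀ᵐ ω ∂P, |(P[f | Z]) ω| ≤ 1 :=
      ae_bdd_abs_condExp_of_ae_bdd_abs (ae_of_all _ fun ω => by
        rw [abs_of_nonneg (hf0 ω).1]; exact (hf0 ω).2)
    filter_upwards [h0, h1] with ω h0 h1
    simp only [hgdef]
    rw [min_eq_right (abs_le.1 h1).2, max_eq_right (show (0 : ℝ) ≤ (P[f | Z]) ω from h0)]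
  set h : Ω → ℝ := fun ω => f ω - g ω with hh
  have hhm : Measurable h := hfm.sub (hg.mono hZ le_rfl)
  have hh1 : ∀ ω, |h ω| ≤ 1 := fun ω => abs_le.2
    ⟨by simp only [hh]; linarith [(hf0 ω).1, hg1 ω], by simp only [hh]; linarith [(hf0 ω).2, hg0 ω]⟩
  set x : ℕ → Ω → ℝ := fun k ω => a k ω * h (T^[k] ω) with hx
  have hxm : ∀ k, 1 ≤ k → Measurable (x k) := fun k hk =>
    (ham k hk).mul (hhm.comp (hT.iterate k).measurable)
  have hx1 : ∀ k ω, |x k ω| ≤ 1 := fun k ω => by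
    simp only [hx]
    rw [abs_mul]; exact mul_le_one₀ (ha1 _ _) (abs_nonneg _) (hh1 _)
  have hsm := second_moment (P := P) hxm hx1 (ρ := fun i => ∫ ω, |cov P S Z B i ω| ∂P)
    (fun i => integral_nonneg fun ω => abs_nonneg _)
    (fun j k hj hjk => cross_moment hT hS hTS hZ hZT hB hg hg0 hg1 hgB ha ha1 hh hj hjk)
  set X : ℕ → Ω → ℝ := fun n ω => (n : ℝ)⁻¹ * ∑ k ∈ Finset.Icc 1 n, x k ω with hX
  have hXm : ∀ n, Measurable (X n) := fun n =>
    (Finset.measurable_sum _ (fun k hk => hxm k (Finset.mem_Icc.1 hk).1)).const_mul _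
  have hXb : ∀ n ω, |X n ω| ≤ 1 := fun n ω => by
    simp only [hX]
    rw [abs_mul, abs_of_nonneg (by positivity : (0 : ℝ) ≤ (n : ℝ)⁻¹)]
    calc _ ≤ (n : ℝ)⁻¹ * n := by
          refine mul_le_mul_of_nonneg_left ?_ (by positivity)
          refine (Finset.abs_sum_le_sum_abs _ _).trans ?_
          refine (Finset.sum_le_sum (fun k _ => hx1 k ω)).trans ?_
          simp
      _ ≤ 1 := inv_mul_le_one
  have hlim : Tendsto (fun n => ∫ ω, |X n ω| ∂P) atTop (𝓝 0) := by
    refine tendsto_integral_abs_of_sq (fun n => integrable_of_bdd (hXm n) 1 (hXb n))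
      (fun n => integrable_of_bdd ((hXm n).pow_const 2) 1 fun ω => by
        rw [abs_pow]; exact pow_le_one₀ (abs_nonneg _) (hXb n ω)) ?_
    have hc := (cesaro_cov hWM hB).const_mul 2
    rw [mul_zero] at hc
    refine squeeze_zero (fun n => integral_nonneg fun ω => sq_nonneg _) (fun n => ?_) hc
    simp only [hX, mul_pow]
    rw [integral_const_mul]
    rcases Nat.eq_zero_or_pos n with rfl | hn
    · simp
    · have hn' : (0 : ℝ) < n := by exact_mod_cast hn
      calc _ ≤ ((n : ℝ)⁻¹) ^ 2 * (2 * n * ∑ i ∈ Finset.range n, ∫ ω, |cov P S Z B i ω| ∂P) :=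
            mul_le_mul_of_nonneg_left (hsm n) (by positivity)
        _ = _ := by field_simp
  refine hlim.congr fun n => integral_congr_ae ?_
  filter_upwards [ae_iter hT hgB] with ω hω
  simp only [hX, hx, hh, wavg, hω]

lemma wavg_tendsto (hT : MeasurePreserving T P P)
    (hS : MeasurePreserving S P P) (hTS : Function.RightInverse S T)
    (hZ : Z ≤ m0) (hZT : Z ≤ MeasurableSpace.comap T Z) (hWM : CondWeakMixing P S Z)
    {a : ℕ → Ω → ℝ} (ha : ∀ k, 1 ≤ k → Measurable[MeasurableSpace.comap (T^[k]) Z] (a k))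
    (ha1 : ∀ k ω, |a k ω| ≤ 1) {f : Ω → ℝ} (hf : Integrable f P) :
    Tendsto (fun n => ∫ ω, |wavg P T Z a f n ω| ∂P) atTop (𝓝 0) := by
  have hle : ∀ k, MeasurableSpace.comap (T^[k]) Z ≤ m0 := by
    rintro k s ⟨t, ht, rfl⟩
    exact (hT.iterate k).measurable (hZ t ht)
  have ham : ∀ k, 1 ≤ k → Measurable (a k) := fun k hk => (ha k hk).mono (hle k) le_rfl
  have tri : ∀ f g : Ω → ℝ, Integrable f P → Integrable g P → ∀ n,
      ∫ ω, |wavg P T Z a (f + g) n ω| ∂P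
        ≤ ∫ ω, |wavg P T Z a f n ω| ∂P + ∫ ω, |wavg P T Z a g n ω| ∂P := by
    intro f g hf hg n
    have i1 := (wavg_integrable (Z := Z) hT ham ha1 hf n).abs
    have i2 := (wavg_integrable (Z := Z) hT ham ha1 hg n).abs
    rw [← integral_add i1 i2]
    refine integral_mono_ae (wavg_integrable hT ham ha1 (hf.add hg) n).abs (i1.add i2) ?_
    filter_upwards [wavg_add (Z := Z) hT a hf hg n] with ω hω
    simp only [hω]
    exact abs_add_le _ _
  refine Integrable.induction
    (P := fun f => Tendsto (fun n => ∫ ω, |wavg P T Z a f n ω| ∂P) atTop (𝓝 0)) ?_ ?_ ?_ ?_ hf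
  · intro c s hs _
    have e : (s.indicator fun _ => c) = c • (s.indicator fun _ => (1 : ℝ)) := by
      ext ω; by_cases h : ω ∈ s <;> simp [h]
    rw [e]
    have h := (wavg_indicator hT hS hTS hZ hZT hWM ha ha1 hs).const_mul |c|
    rw [mul_zero] at h
    refine h.congr fun n => ?_
    rw [← integral_const_mul]
    refine integral_congr_ae ?_
    filter_upwards [wavg_smul (Z := Z) hT a c (s.indicator fun _ => (1 : ℝ)) n] with ω hω
    rw [hω, abs_mul]
  · intro f g _ hf hg h1 h2
    have h := h1.add h2
    rw [add_zero] at h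
    exact squeeze_zero (fun n => integral_nonneg fun ω => abs_nonneg _) (tri f g hf hg) h
  · refine isClosed_of_closure_subset fun F hF => ?_
    rw [Metric.mem_closure_iff] at hF
    simp only [Set.mem_ofPred_eq] at hF ⊢
    rw [Metric.tendsto_atTop]
    intro ε hε
    obtain ⟨G, hG, hFG⟩ := hF (ε / 4) (by positivity)
    obtain ⟨N, hN⟩ := (Metric.tendsto_atTop.1 hG) (ε / 2) (by positivity)
    refine ⟨N, fun n hn => ?_⟩
    have h1 := hN n hn
    rw [Real.dist_eq, sub_zero, abs_of_nonneg (integral_nonneg fun ω => abs_nonneg _)] at h1 ⊢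
    have hGi := L1.integrable_coeFn G
    have hDi : Integrable (fun ω => F ω - G ω) P := (L1.integrable_coeFn F).sub hGi
    have h2 := tri _ _ hGi hDi n
    have e : ((G : Ω → ℝ) + fun ω => F ω - G ω) = F := by ext ω; simp
    rw [e] at h2
    have h3 := wavg_bound (Z := Z) hT ham ha1 hDi n
    have h4 : ∫ ω, |F ω - G ω| ∂P = dist F G := by
      rw [L1.dist_eq_integral_dist]
      simp only [Real.dist_eq]
    rw [h4] at h3
    linarith
  · intro f g hfg _ h
    refine h.congr fun n => integral_congr_ae ?_
    filter_upwards [wavg_congr (Z := Z) hT a hfg n] with ω hω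
    rw [hω]

end wavg

section fields

variable {Ω : Type*}

lemma iter_T {T S : Ω → Ω} (hST : Function.LeftInverse S T) (m : ℤ) (ω : Ω) :
    iter T S m (T ω) = iter T S (m + 1) ω := by
  cases m with
  | ofNat n => rfl
  | negSucc n =>
    cases n with
    | zero =>
      change S (T ω) = ω
      exact hST ω
    | succ n =>
      change S^[n + 1] (S (T ω)) = S^[n + 1] ω
      rw [hST ω]

lemma iter_T_iter {T S : Ω → Ω} (hST : Function.LeftInverse S T) (m : ℤ) (n : ℕ) (ω : Ω) :
    iter T S m (T^[n] ω) = iter T S (m + n) ω := by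
  induction n generalizing m ω with
  | zero => simp
  | succ n ih =>
    rw [Function.iterate_succ_apply', iter_T hST, ih]
    congr 1
    push_cast; ring

lemma comap_iter {T S : Ω → Ω} (hST : Function.LeftInverse S T) (Y : MeasurableSpace Ω)
    (m : ℤ) (n : ℕ) :
    MeasurableSpace.comap (T^[n]) (MeasurableSpace.comap (iter T S m) Y)
      = MeasurableSpace.comap (iter T S (m + n)) Y := by
  rw [MeasurableSpace.comap_comp]
  congr 1
  funext ω
  exact iter_T_iter hST m n ω

lemma iter_measurable {m0 : MeasurableSpace Ω} {T S : Ω → Ω} (hT : Measurable T)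
    (hS : Measurable S) (m : ℤ) : Measurable (iter T S m) := by
  cases m with
  | ofNat n => exact hT.iterate n
  | negSucc n => exact hS.iterate (n + 1)

lemma comap_iter_le {m0 : MeasurableSpace Ω} {T S : Ω → Ω} (hT : Measurable T)
    (hS : Measurable S) {Y : MeasurableSpace Ω} (hY : Y ≤ m0) (m : ℤ) :
    MeasurableSpace.comap (iter T S m) Y ≤ m0 := by
  rintro s ⟨t, ht, rfl⟩
  exact iter_measurable hT hS m (hY t ht)

lemma obsFieldLE_le {m0 : MeasurableSpace Ω} {T S : Ω → Ω} (hT : Measurable T)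
    (hS : Measurable S) {Y : MeasurableSpace Ω} (hY : Y ≤ m0) (n : ℤ) :
    obsFieldLE T S Y n ≤ m0 :=
  iSup₂_le fun k _ => comap_iter_le hT hS hY k

lemma obsField_le_LE (T S : Ω → Ω) (Y : MeasurableSpace Ω) (m n : ℤ) :
    obsField T S Y m n ≤ obsFieldLE T S Y n :=
  iSup₂_le fun k hk => le_iSup₂_of_le (f := fun k (_ : k ∈ Set.Iic n) =>
    MeasurableSpace.comap (iter T S k) Y) k hk.2 le_rfl

lemma obsFieldLE_le_comap {T S : Ω → Ω} (hST : Function.LeftInverse S T)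
    (Y : MeasurableSpace Ω) :
    obsFieldLE T S Y 0 ≤ MeasurableSpace.comap T (obsFieldLE T S Y 0) := by
  refine iSup₂_le fun k hk => ?_
  have h := comap_iter hST Y (k - 1) 1
  rw [show k - 1 + ((1 : ℕ) : ℤ) = k by push_cast; ring] at h
  rw [← h]
  refine MeasurableSpace.comap_mono ?_
  have hk' : k ≤ 0 := hk
  exact le_iSup₂_of_le (f := fun k (_ : k ∈ Set.Iic (0 : ℤ)) =>
    MeasurableSpace.comap (iter T S k) Y) (k - 1) (show k - 1 ≤ 0 by omega) le_rfl

lemma obsField_shift {T S : Ω → Ω} (hST : Function.LeftInverse S T)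
    (Y : MeasurableSpace Ω) (n : ℕ) :
    obsField T S Y 0 n = MeasurableSpace.comap (T^[n]) (obsField T S Y (-n) 0) := by
  apply le_antisymm
  · refine iSup₂_le fun k hk => ?_
    have h := comap_iter hST Y (k - n) n
    rw [show k - n + (n : ℤ) = k by ring] at h
    rw [← h]
    refine MeasurableSpace.comap_mono ?_
    have h1 : 0 ≤ k := hk.1
    have h2 : k ≤ n := hk.2
    exact le_iSup₂_of_le (f := fun k (_ : k ∈ Set.Icc (-n : ℤ) 0) =>
      MeasurableSpace.comap (iter T S k) Y) (k - n) ⟨by omega, by omega⟩ le_rfl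
  · unfold obsField
    simp only [MeasurableSpace.comap_iSup]
    refine iSup₂_le fun k hk => ?_
    rw [comap_iter hST Y k n]
    have h1 : -(n : ℤ) ≤ k := hk.1
    have h2 : k ≤ 0 := hk.2
    exact le_iSup₂_of_le (f := fun k (_ : k ∈ Set.Icc (0 : ℤ) n) =>
      MeasurableSpace.comap (iter T S k) Y) (k + n) ⟨by omega, by omega⟩ le_rfl

lemma obsField_mono (T S : Ω → Ω) (Y : MeasurableSpace Ω) :
    Monotone (fun n : ℕ => obsField T S Y (-n) 0) := by
  intro i j hij
  refine iSup₂_le fun k hk => ?_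
  have h1 : -(i : ℤ) ≤ k := hk.1
  exact le_iSup₂_of_le (f := fun k (_ : k ∈ Set.Icc (-j : ℤ) 0) =>
      MeasurableSpace.comap (iter T S k) Y) k ⟨by omega, hk.2⟩ le_rfl

lemma iSup_obsField (T S : Ω → Ω) (Y : MeasurableSpace Ω) :
    ⨆ n : ℕ, obsField T S Y (-n) 0 = obsFieldLE T S Y 0 := by
  apply le_antisymm
  · exact iSup_le fun n => obsField_le_LE T S Y _ _
  · refine iSup₂_le fun k hk => ?_
    have hk' : k ≤ 0 := hk
    refine le_trans ?_ (le_iSup (fun n : ℕ => obsField T S Y (-n) 0) k.natAbs)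
    exact le_iSup₂_of_le (f := fun j (_ : j ∈ Set.Icc (-(k.natAbs : ℤ)) 0) =>
      MeasurableSpace.comap (iter T S j) Y) k ⟨by omega, hk'⟩ le_rfl

end fields

lemma exists_rep {Ω U : Type*} {m0 : MeasurableSpace Ω} [MeasurableSpace U] [Finite U]
    {ℓ : U → Ω → ℝ} (hℓ : Measurable fun p : U × Ω => ℓ p.1 p.2) :
    ∃ r : U → U, (∀ c, MeasurableSet (r ⁻¹' {c})) ∧ ∀ u ω, ℓ (r u) ω = ℓ u ω := by
  classical
  have key : ∀ u v : U, v ∈ measurableAtom u → measurableAtom v = measurableAtom u := by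
    intro u v hv
    have hu := MeasurableSet.measurableAtom_of_countable u
    have hv' := MeasurableSet.measurableAtom_of_countable v
    refine Set.Subset.antisymm (measurableAtom_subset hu hv) ?_
    refine measurableAtom_subset hv' ?_
    by_contra hcon
    have := mem_of_mem_measurableAtom hv (hu.diff hv') ⟨mem_measurableAtom_self u, hcon⟩
    exact this.2 (mem_measurableAtom_self v)
  have hex : ∀ A : Set U, ∃ c : U → U, ∀ u, measurableAtom u = A → measurableAtom (c u) = A ∧
      ∀ v, measurableAtom v = A → c v = c u := by
    intro A
    by_cases h : ∃ x, measurableAtom x = A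
    · obtain ⟨x, hx⟩ := h
      exact ⟨fun _ => x, fun u _ => ⟨hx, fun v _ => rfl⟩⟩
    · exact ⟨id, fun u hu => absurd ⟨u, hu⟩ h⟩
  choose c hc using hex
  set r : U → U := fun u => c (measurableAtom u) u with hr
  have hr1 : ∀ u, measurableAtom (r u) = measurableAtom u := fun u => (hc _ u rfl).1
  have hr2 : ∀ u v, measurableAtom v = measurableAtom u → r v = r u := by
    intro u v h
    simp only [hr]
    rw [h]
    exact (hc _ u rfl).2 v h
  refine ⟨r, fun x => ?_, fun u ω => ?_⟩
  · by_cases hx : ∃ u, r u = x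
    · obtain ⟨u, rfl⟩ := hx
      have : r ⁻¹' {r u} = measurableAtom u := by
        ext v
        simp only [Set.mem_preimage, Set.mem_singleton_iff]
        constructor
        · intro h
          have : measurableAtom v = measurableAtom u := by rw [← hr1 v, h, hr1 u]
          rw [← this]; exact mem_measurableAtom_self v
        · intro h
          exact hr2 u v (key u v h)
      rw [this]; exact MeasurableSet.measurableAtom_of_countable u
    · have : r ⁻¹' {x} = ∅ := by
        ext v
        simp only [Set.mem_preimage, Set.mem_singleton_iff, Set.mem_empty_iff_false, iff_false]
        exact fun h => hx ⟨v, h⟩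
      rw [this]; exact MeasurableSet.empty
  · have hm : Measurable (fun v => ℓ v ω) := hℓ.comp (measurable_id.prodMk measurable_const)
    have hmem : r u ∈ measurableAtom u := by
      rw [← hr1 u]; exact mem_measurableAtom_self _
    exact mem_of_mem_measurableAtom hmem (hm (measurableSet_singleton (ℓ u ω))) rfl

/-- difference between the average loss and the average of its conditional expectations -/
def fluct (P : Measure Ω) (T S : Ω → Ω) (Y : MeasurableSpace Ω) (ℓ : U → Ω → ℝ) (u : ℕ → Ω → U)
    (n : ℕ) (ω : Ω) : ℝ :=
  avgLoss T S ℓ u n ω - (n : ℝ)⁻¹ * ∑ k ∈ Finset.Icc 1 n,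
    (P[lossAt T S ℓ (k : ℤ) (u k) | obsField T S Y 0 (k : ℤ)]) ω

lemma delta_tendsto {Ω : Type*} {Y m0 : MeasurableSpace Ω} {P : Measure Ω}
    [IsProbabilityMeasure P] {T S : Ω → Ω} (hT : MeasurePreserving T P P)
    (hS : MeasurePreserving S P P) (hST : Function.LeftInverse S T) (hY : Y ≤ m0)
    {f : Ω → ℝ} (hf : Integrable f P) :
    Tendsto (fun k : ℕ => ∫ ω, |(P[f | obsFieldLE T S Y 0]) (T^[k] ω)
      - (P[fun ω => f (T^[k] ω) | obsField T S Y 0 (k : ℤ)]) ω| ∂P) atTop (𝓝 0) := by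
  have hZ : obsFieldLE T S Y 0 ≤ m0 := obsFieldLE_le hT.measurable hS.measurable hY 0
  let F : Filtration ℕ m0 := ⟨fun n => obsField T S Y (-n) 0, obsField_mono T S Y,
    fun n => (obsField_le_LE T S Y _ _).trans hZ⟩
  have h := tendsto_eLpNorm_condExp (μ := P) (ℱ := F) f
  have hsup : (⨆ n, F n) = obsFieldLE T S Y 0 := iSup_obsField T S Y
  rw [hsup] at h
  have h2 := (ENNReal.tendsto_toReal ENNReal.zero_ne_top).comp h
  rw [ENNReal.toReal_zero] at h2
  refine h2.congr fun k => ?_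
  have hI : Integrable (P[f | F k] - P[f | obsFieldLE T S Y 0]) P :=
    integrable_condExp.sub integrable_condExp
  simp only [Function.comp]
  rw [eLpNorm_one_eq_lintegral_enorm, ← integral_norm_eq_lintegral_enorm hI.1,
    ← integral_comp_mp (hT.iterate k) hI.norm.1]
  refine integral_congr_ae ?_
  have hc := condExp_comp_mp (hT.iterate k) (F.le k) hf
  have hc' : P[fun ω => f (T^[k] ω) | obsField T S Y 0 (k : ℤ)]
      =ᵐ[P] fun ω => (P[f | F k]) (T^[k] ω) := by
    rw [obsField_shift hST Y k]; exact hc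
  filter_upwards [hc'] with ω hω
  rw [hω, Real.norm_eq_abs, abs_sub_comm]
  rfl

lemma cesaro_Icc {x : ℕ → ℝ} (hx : Tendsto x atTop (𝓝 0)) :
    Tendsto (fun n : ℕ => (n : ℝ)⁻¹ * ∑ k ∈ Finset.Icc 1 n, x k) atTop (𝓝 0) := by
  have h := ((tendsto_add_atTop_iff_nat 1).2 hx).cesaro
  refine h.congr fun n => ?_
  congr 1
  rw [Finset.range_eq_Ico, Finset.sum_Ico_add' x 0 n 1]
  rfl

lemma fluct_tendsto {Ω U : Type*} {Y m0 : MeasurableSpace Ω} [MeasurableSpace U] [Finite U]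
    {P : Measure Ω} [IsProbabilityMeasure P]
    {T S : Ω → Ω} (hT : MeasurePreserving T P P) (hS : MeasurePreserving S P P)
    (hST : Function.LeftInverse S T) (hTS : Function.RightInverse S T)
    {ℓ : U → Ω → ℝ} (hℓ : Measurable fun p : U × Ω => ℓ p.1 p.2)
    {Λ : Ω → ℝ} (hΛ : Integrable Λ P) (hdom : ∀ u ω, |ℓ u ω| ≤ Λ ω)
    (hY : Y ≤ m0) (hWM : CondWeakMixing P S (obsFieldLE T S Y 0))
    {u : ℕ → Ω → U} (hu : Admissible T S Y u) :
    (∀ n, Integrable (fluct P T S Y ℓ u n) P) ∧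
      Tendsto (fun n => ∫ ω, |fluct P T S Y ℓ u n ω| ∂P) atTop (𝓝 0) := by
  classical
  have := Fintype.ofFinite U
  have hZ : (obsFieldLE T S Y 0) ≤ m0 := obsFieldLE_le hT.measurable hS.measurable hY 0
  have hZT : (obsFieldLE T S Y 0) ≤ MeasurableSpace.comap T (obsFieldLE T S Y 0) := obsFieldLE_le_comap hST Y
  have hWZ : ∀ k : ℕ, obsField T S Y 0 (k : ℤ) ≤ MeasurableSpace.comap (T^[k]) (obsFieldLE T S Y 0) := fun k => by
    rw [obsField_shift hST Y k]
    exact MeasurableSpace.comap_mono (obsField_le_LE T S Y _ _)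
  have hZk : ∀ k, MeasurableSpace.comap (T^[k]) (obsFieldLE T S Y 0) ≤ m0 := by
    rintro k s ⟨t, ht, rfl⟩
    exact (hT.iterate k).measurable (hZ t ht)
  have hW : ∀ k : ℕ, obsField T S Y 0 (k : ℤ) ≤ m0 := fun k => (hWZ k).trans (hZk k)
  have hfI : ∀ c, Integrable (ℓ c) P := fun c =>
    hΛ.mono' (hℓ.comp (measurable_const.prodMk measurable_id)).aestronglyMeasurable
      (ae_of_all _ fun ω => hdom c ω)
  obtain ⟨r, hr, hrl⟩ := exists_rep hℓ
  set a : U → ℕ → Ω → ℝ := fun c k ω => if r (u k ω) = c then 1 else 0 with ha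
  have haW : ∀ c (k : ℕ), 1 ≤ k → Measurable[obsField T S Y 0 (k : ℤ)] (a c k) := by
    intro c k hk
    have hset : MeasurableSet[obsField T S Y 0 (k : ℤ)] {ω | r (u k ω) = c} :=
      (show Measurable[obsField T S Y 0 (k : ℤ)] (u k) from hu k hk) (hr c)
    exact Measurable.ite hset measurable_const measurable_const
  have haZ : ∀ c k, 1 ≤ k → Measurable[MeasurableSpace.comap (T^[k]) (obsFieldLE T S Y 0)] (a c k) :=
    fun c k hk => (haW c k hk).mono (hWZ k) le_rfl
  have ham : ∀ c k, 1 ≤ k → Measurable (a c k) := fun c k hk => (haW c k hk).mono (hW k) le_rfl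
  have ha1 : ∀ c k ω, |a c k ω| ≤ 1 := fun c k ω => by
    simp only [ha]; split_ifs <;> simp
  have hloss : ∀ k : ℕ, lossAt T S ℓ (k : ℤ) (u k)
      = ∑ c, fun ω => a c k ω * ℓ c (T^[k] ω) := by
    intro k
    ext ω
    rw [Finset.sum_apply]
    simp only [ha, ite_mul, one_mul, zero_mul, Finset.sum_ite_eq, Finset.mem_univ, if_true, hrl]
    rfl
  have hfk : ∀ c (k : ℕ), Integrable (fun ω => ℓ c (T^[k] ω)) P := fun c k =>
    (hT.iterate k).integrable_comp_of_integrable (hfI c)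
  have htI : ∀ c k, 1 ≤ k → Integrable (fun ω => a c k ω * ℓ c (T^[k] ω)) P := fun c k hk =>
    wavg_term_integrable hT (ham c) (ha1 c) (hfI c) hk
  have hcond : ∀ k : ℕ, 1 ≤ k → P[lossAt T S ℓ (k : ℤ) (u k) | obsField T S Y 0 (k : ℤ)]
      =ᵐ[P] fun ω => ∑ c, a c k ω *
        (P[fun ω => ℓ c (T^[k] ω) | obsField T S Y 0 (k : ℤ)]) ω := by
    intro k hk
    rw [hloss k]
    have h1 := condExp_finsetSum (μ := P) (s := Finset.univ)
      (f := fun c => fun ω => a c k ω * ℓ c (T^[k] ω))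
      (fun c _ => htI c k hk) (obsField T S Y 0 (k : ℤ))
    have h2 : ∀ᵐ ω ∂P, ∀ c, (P[fun ω => a c k ω * ℓ c (T^[k] ω) | obsField T S Y 0 (k : ℤ)]) ω
        = a c k ω * (P[fun ω => ℓ c (T^[k] ω) | obsField T S Y 0 (k : ℤ)]) ω :=
      ae_all_iff.2 fun c => condExp_mul_of_stronglyMeasurable_left
        (haW c k hk).stronglyMeasurable (htI c k hk) (hfk c k)
    filter_upwards [h1, h2] with ω h1 h2
    rw [h1, Finset.sum_apply]
    exact Finset.sum_congr rfl fun c _ => h2 c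
  set d : U → ℕ → Ω → ℝ := fun c k ω => (P[ℓ c | (obsFieldLE T S Y 0)]) (T^[k] ω)
      - (P[fun ω => ℓ c (T^[k] ω) | obsField T S Y 0 (k : ℤ)]) ω with hd
  have hdI : ∀ c k, Integrable (d c k) P := fun c k =>
    ((hT.iterate k).integrable_comp_of_integrable integrable_condExp).sub integrable_condExp
  have hadI : ∀ c k, 1 ≤ k → Integrable (fun ω => a c k ω * d c k ω) P := fun c k hk =>
    (hdI c k).bdd_mul (c := 1) (ham c k hk).aestronglyMeasurable (ae_of_all _ (ha1 c k))
  set E : U → ℕ → Ω → ℝ := fun c n ω => (n : ℝ)⁻¹ * ∑ k ∈ Finset.Icc 1 n, a c k ω * d c k ω with hE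
  have hEI : ∀ c n, Integrable (E c n) P := fun c n =>
    (integrable_finsetSum _ fun k hk => hadI c k (Finset.mem_Icc.1 hk).1).const_mul _
  have hEt : ∀ c, Tendsto (fun n => ∫ ω, |E c n ω| ∂P) atTop (𝓝 0) := by
    intro c
    refine squeeze_zero (fun n => integral_nonneg fun ω => abs_nonneg _) (fun n => ?_)
      (cesaro_Icc (delta_tendsto hT hS hST hY (hfI c)))
    refine (avg_L1_bound (hadI c) n).trans ?_
    refine mul_le_mul_of_nonneg_left (Finset.sum_le_sum fun k hk => ?_) (by positivity)
    refine integral_mono (hadI c k (Finset.mem_Icc.1 hk).1).abs (hdI c k).abs fun ω => ?_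
    simp only
    rw [abs_mul]
    exact mul_le_of_le_one_left (abs_nonneg _) (ha1 c k ω)
  have hwI : ∀ c n, Integrable (wavg P T (obsFieldLE T S Y 0) (a c) (ℓ c) n) P := fun c n =>
    wavg_integrable hT (ham c) (ha1 c) (hfI c) n
  have hwt : ∀ c, Tendsto (fun n => ∫ ω, |wavg P T (obsFieldLE T S Y 0) (a c) (ℓ c) n ω| ∂P) atTop (𝓝 0) := fun c =>
    wavg_tendsto hT hS hTS hZ hZT hWM (haZ c) (ha1 c) (hfI c)
  have hfl : ∀ n, fluct P T S Y ℓ u n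
      =ᵐ[P] fun ω => ∑ c, (wavg P T (obsFieldLE T S Y 0) (a c) (ℓ c) n ω + E c n ω) := by
    intro n
    have hall : ∀ᵐ ω ∂P, ∀ k : ℕ, 1 ≤ k →
        (P[lossAt T S ℓ (k : ℤ) (u k) | obsField T S Y 0 (k : ℤ)]) ω = ∑ c, a c k ω *
        (P[fun ω => ℓ c (T^[k] ω) | obsField T S Y 0 (k : ℤ)]) ω := by
      rw [ae_all_iff]
      intro k
      by_cases hk : 1 ≤ k
      · filter_upwards [hcond k hk] with ω hω _ using hω
      · exact ae_of_all _ fun ω h => absurd h hk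
    filter_upwards [hall] with ω hω
    simp only [fluct, avgLoss, wavg, hE, hd]
    simp only [← mul_add, ← Finset.sum_add_distrib, ← Finset.mul_sum]
    rw [← mul_sub, ← Finset.sum_sub_distrib, Finset.sum_comm]
    congr 1
    refine Finset.sum_congr rfl fun k hk => ?_
    rw [hω k (Finset.mem_Icc.1 hk).1, hloss k, Finset.sum_apply, ← Finset.sum_sub_distrib]
    refine Finset.sum_congr rfl fun c _ => ?_
    ring
  have hsumI : ∀ n, Integrable (fun ω => ∑ c, (wavg P T (obsFieldLE T S Y 0) (a c) (ℓ c) n ω + E c n ω)) P :=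
    fun n => integrable_finsetSum _ fun c _ => (hwI c n).add (hEI c n)
  refine ⟨fun n => (hsumI n).congr (hfl n).symm, ?_⟩
  have hlim : Tendsto (fun n => ∑ c, (∫ ω, |wavg P T (obsFieldLE T S Y 0) (a c) (ℓ c) n ω| ∂P
      + ∫ ω, |E c n ω| ∂P)) atTop (𝓝 0) := by
    have := tendsto_finset_sum Finset.univ (fun c _ => (hwt c).add (hEt c))
    simpa using this
  refine squeeze_zero (fun n => integral_nonneg fun ω => abs_nonneg _) (fun n => ?_) hlim
  have hI2 : ∀ c, Integrable (fun ω => |wavg P T (obsFieldLE T S Y 0) (a c) (ℓ c) n ω| + |E c n ω|) P := fun c =>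
    (hwI c n).abs.add (hEI c n).abs
  calc _ ≤ ∫ ω, ∑ c, (|wavg P T (obsFieldLE T S Y 0) (a c) (ℓ c) n ω| + |E c n ω|) ∂P := by
        refine integral_mono_ae ((hsumI n).congr (hfl n).symm).abs
          (integrable_finsetSum _ fun c _ => hI2 c) ?_
        filter_upwards [hfl n] with ω hω
        simp only [hω]
        exact (Finset.abs_sum_le_sum_abs _ _).trans
          (Finset.sum_le_sum fun c _ => abs_add_le _ _)
    _ = _ := by
        rw [integral_finsetSum _ fun c _ => hI2 c]
        exact Finset.sum_congr rfl fun c _ => integral_add (hwI c n).abs (hEI c n).abs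

end helpers

/-- Theorem 1.6: if the decision space `U` is finite and the system is
conditionally weak mixing relative to `𝒴_{-∞,0}`, then every mean-optimal strategy is
weakly pathwise optimal. -/
theorem statement1
    {Ω U : Type*} [m0 : MeasurableSpace Ω] [MeasurableSpace U] [Finite U]
    (P : Measure Ω) [IsProbabilityMeasure P]
    (T S : Ω → Ω) (hT : Ergodic T P) (hS : MeasurePreserving S P P)
    (hST : Function.LeftInverse S T) (hTS : Function.RightInverse S T)
    (ℓ : U → Ω → ℝ) (hℓ : Measurable fun p : U × Ω => ℓ p.1 p.2)
    (Λ : Ω → ℝ) (hΛ : Integrable Λ P) (hdom : ∀ u ω, |ℓ u ω| ≤ Λ ω)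
    (Y : MeasurableSpace Ω) (hY : Y ≤ m0)
    (hWM : CondWeakMixing P S (obsFieldLE T S Y 0))
    (ut : ℕ → Ω → U) (hut : MeanOptimalStrategy P T S Y ℓ ut) :
    WeaklyPathwiseOptimal P T S Y ℓ ut := by
  have hTm := hT.toMeasurePreserving
  refine ⟨hut.1, fun u hu ε hε => ?_⟩
  obtain ⟨hI1, ht1⟩ := fluct_tendsto hTm hS hST hTS hℓ hΛ hdom hY hWM hu
  obtain ⟨hI2, ht2⟩ := fluct_tendsto hTm hS hST hTS hℓ hΛ hdom hY hWM hut.1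
  have hc := cesaro_Icc (tendsto_inv_atTop_nhds_zero_nat (𝕜 := ℝ))
  have hmean : ∀ᵐ ω ∂P, ∀ k : ℕ, 1 ≤ k →
      (P[lossAt T S ℓ (k : ℤ) (ut k) | obsField T S Y 0 (k : ℤ)]) ω
        ≤ (P[lossAt T S ℓ (k : ℤ) (u k) | obsField T S Y 0 (k : ℤ)]) ω + (k : ℝ)⁻¹ := by
    rw [ae_all_iff]
    intro k
    by_cases hk : 1 ≤ k
    · obtain ⟨g, ⟨_, hg, _⟩, hgk⟩ := hut.2 k hk
      filter_upwards [hg (u k) (hu k hk), hgk] with ω h1 h2 _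
      linarith
    · exact ae_of_all _ fun ω h => absurd h hk
  set W : ℕ → Ω → ℝ := fun n ω => |fluct P T S Y ℓ u n ω| + |fluct P T S Y ℓ ut n ω| with hW
  have hWI : ∀ n, Integrable (W n) P := fun n => (hI1 n).abs.add (hI2 n).abs
  have hWt : Tendsto (fun n => ∫ ω, W n ω ∂P) atTop (𝓝 0) := by
    have h := ht1.add ht2
    rw [add_zero] at h
    exact h.congr fun n => (integral_add (hI1 n).abs (hI2 n).abs).symm
  have hlow : Tendsto (fun n => 1 - ENNReal.ofReal ((ε / 2)⁻¹ * ∫ ω, W n ω ∂P)) atTop (𝓝 1) := by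
    have h := ENNReal.tendsto_ofReal (hWt.const_mul (ε / 2)⁻¹)
    rw [mul_zero, ENNReal.ofReal_zero] at h
    have h2 := ENNReal.Tendsto.sub (tendsto_const_nhds (x := (1 : ℝ≥0∞)) (f := atTop)) h
      (Or.inl ENNReal.one_ne_top)
    simpa using h2
  refine tendsto_of_tendsto_of_tendsto_of_le_of_le' hlow tendsto_const_nhds ?_
    (Eventually.of_forall fun n => prob_le_one)
  filter_upwards [hc.eventually_lt_const (half_pos hε)] with n hn
  set A : Set Ω := {ω | -ε ≤ avgLoss T S ℓ u n ω - avgLoss T S ℓ ut n ω} with hA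
  have hbad : P Aᶜ ≤ P {ω | ε / 2 ≤ W n ω} := by
    refine measure_mono_ae ?_
    filter_upwards [hmean] with ω hω hωA
    change ε / 2 ≤ W n ω
    have h1 : avgLoss T S ℓ u n ω - avgLoss T S ℓ ut n ω < -ε := not_le.1 hωA
    have h2 : (n : ℝ)⁻¹ * ∑ k ∈ Finset.Icc 1 n,
          (P[lossAt T S ℓ (k : ℤ) (ut k) | obsField T S Y 0 (k : ℤ)]) ω
        ≤ (n : ℝ)⁻¹ * ∑ k ∈ Finset.Icc 1 n,
          (P[lossAt T S ℓ (k : ℤ) (u k) | obsField T S Y 0 (k : ℤ)]) ω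
          + (n : ℝ)⁻¹ * ∑ k ∈ Finset.Icc 1 n, (k : ℝ)⁻¹ := by
      rw [← mul_add, ← Finset.sum_add_distrib]
      exact mul_le_mul_of_nonneg_left
        (Finset.sum_le_sum fun k hk => hω k (Finset.mem_Icc.1 hk).1) (by positivity)
    have h3 := neg_abs_le (fluct P T S Y ℓ u n ω)
    have h4 := le_abs_self (fluct P T S Y ℓ ut n ω)
    simp only [hW]
    have e3 : fluct P T S Y ℓ u n ω = avgLoss T S ℓ u n ω - (n : ℝ)⁻¹ * ∑ k ∈ Finset.Icc 1 n,
      (P[lossAt T S ℓ (k : ℤ) (u k) | obsField T S Y 0 (k : ℤ)]) ω := rfl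
    have e4 : fluct P T S Y ℓ ut n ω = avgLoss T S ℓ ut n ω - (n : ℝ)⁻¹ * ∑ k ∈ Finset.Icc 1 n,
      (P[lossAt T S ℓ (k : ℤ) (ut k) | obsField T S Y 0 (k : ℤ)]) ω := rfl
    linarith
  have hmarkov : P {ω | ε / 2 ≤ W n ω} ≤ ENNReal.ofReal ((ε / 2)⁻¹ * ∫ ω, W n ω ∂P) := by
    have hm := mul_meas_ge_le_integral_of_nonneg
      (ae_of_all P fun ω => add_nonneg (abs_nonneg _) (abs_nonneg _)) (hWI n) (ε / 2)
    rw [← ENNReal.ofReal_toReal (measure_ne_top P {ω | ε / 2 ≤ W n ω})]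
    refine ENNReal.ofReal_le_ofReal ?_
    rw [le_inv_mul_iff₀ (half_pos hε)]
    exact hm
  rw [tsub_le_iff_right]
  calc (1 : ℝ≥0∞) = P (A ∪ Aᶜ) := by rw [Set.union_compl_self, measure_univ]
    _ ≤ P A + P Aᶜ := measure_union_le _ _
    _ ≤ _ := by gcongr; exact hbad.trans hmarkov

end ErgodicDecisions
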